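/- arXiv:1705.05256 — 7 statements merged into one kernel-verified Lean document; each statement's English description precedes it below -/
import Mathlib

section
/- Let N \ge 2 and E \ge 1 be natural numbers, let u_1 < u_2 < ... < u_M be distinct primes where M = 2 \cdot E \cdot \lfloor \log_{u_1} N \rfloor + 1, and let T be a subset of (-\lceil N/2 \rceil, \lfloor N/2 \rfloor] \cap \mathbb{Z} with |T| \le E. Then for every x \in (-\lceil N/2 \rceil, \lfloor N/2 \rfloor] \cap \mathbb{Z}, the number of indices m \in {1, ..., M} such that x \not\equiv t (mod u_m) for all t \in T \setminus {x} is strictly greater than M/2. -/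
/-- Let `N ≥ 2` and `E ≥ 1` be natural numbers, let `u_1 < … < u_M` be
distinct primes where `M = 2·E·⌊log_{u_1} N⌋ + 1`, and let `T` be a subset of
`(-⌈N/2⌉, ⌊N/2⌋] ∩ ℤ` with `|T| ≤ E`. Then for every `x ∈ (-⌈N/2⌉, ⌊N/2⌋] ∩ ℤ`, the number
of indices `m ∈ {1, …, M}` such that `x ≢ t (mod u_m)` for all `t ∈ T \ {x}` is strictly
greater than `M/2`. -/
theorem stmt4 (N E M : ℕ) (hN : 2 ≤ N) (hE : 1 ≤ E) (hM0 : 0 < M)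
    (u : Fin M → ℕ) (hu : ∀ m, (u m).Prime) (hmono : StrictMono u)
    (hM : M = 2 * E * Nat.log (u ⟨0, hM0⟩) N + 1)
    (T : Finset ℤ)
    (hT : T ⊆ Finset.Ioc (-(((N + 1) / 2 : ℕ) : ℤ)) ((N / 2 : ℕ) : ℤ))
    (hTcard : T.card ≤ E)
    (x : ℤ) (hx : x ∈ Finset.Ioc (-(((N + 1) / 2 : ℕ) : ℤ)) ((N / 2 : ℕ) : ℤ)) :
    M < 2 * (Finset.univ.filter (fun m : Fin M =>
        ∀ t ∈ T.erase x, x % (u m : ℤ) ≠ t % (u m : ℤ))).card := by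
  classical
  set L := Nat.log (u ⟨0, hM0⟩) N with hL
  have key : ∀ t ∈ T.erase x, (Finset.univ.filter (fun m : Fin M =>
      x % (u m : ℤ) = t % (u m : ℤ))).card ≤ L := by
    intro t ht
    obtain ⟨hne, htT⟩ := Finset.mem_erase.mp ht
    have h1 := Finset.mem_Ioc.mp (hT htT)
    have h2 := Finset.mem_Ioc.mp hx
    have hd0 : 0 < (x - t).natAbs := by omega
    have hdN : (x - t).natAbs ≤ N := by omega
    set S := Finset.univ.filter (fun m : Fin M => x % (u m : ℤ) = t % (u m : ℤ)) with hS
    have hdvd : ∏ p ∈ S.image u, p ∣ (x - t).natAbs := by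
      apply Finset.prod_primes_dvd
      · intro p hp
        obtain ⟨m, -, rfl⟩ := Finset.mem_image.mp hp
        exact (hu m).prime
      · intro p hp
        obtain ⟨m, hm, rfl⟩ := Finset.mem_image.mp hp
        have h := (Finset.mem_filter.mp hm).2
        exact Int.natCast_dvd.mp (Int.ModEq.dvd (Int.ModEq.symm h))
    rw [Finset.prod_image (fun a _ b _ h => hmono.injective h)] at hdvd
    have hpow : u ⟨0, hM0⟩ ^ S.card ≤ ∏ m ∈ S, u m := by
      apply Finset.pow_card_le_prod
      intro m _
      exact hmono.monotone (Fin.mk_le_of_le_val (Nat.zero_le _))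
    exact Nat.le_log_of_pow_le (hu _).one_lt
      (hpow.trans ((Nat.le_of_dvd hd0 hdvd).trans hdN))
  have hbad : (Finset.univ.filter (fun m : Fin M =>
      ¬ ∀ t ∈ T.erase x, x % (u m : ℤ) ≠ t % (u m : ℤ))).card ≤ E * L := by
    calc _ ≤ ((T.erase x).biUnion (fun t => Finset.univ.filter (fun m : Fin M =>
              x % (u m : ℤ) = t % (u m : ℤ)))).card := by
            apply Finset.card_le_card
            intro m hm
            have h := (Finset.mem_filter.mp hm).2
            push Not at h
            obtain ⟨t, ht, h⟩ := h
            exact Finset.mem_biUnion.mpr ⟨t, ht, Finset.mem_filter.mpr ⟨Finset.mem_univ _, h⟩⟩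
      _ ≤ (T.erase x).card * L := Finset.card_biUnion_le_card_mul _ _ _ key
      _ ≤ E * L := Nat.mul_le_mul_right _ ((Finset.card_erase_le).trans hTcard)
  have htot := Finset.card_filter_add_card_filter_not (s := (Finset.univ : Finset (Fin M)))
    (fun m : Fin M => ∀ t ∈ T.erase x, x % (u m : ℤ) ≠ t % (u m : ℤ))
  rw [Finset.card_univ, Fintype.card_fin] at htot
  rw [mul_assoc] at hM
  have fin : ∀ g b : ℕ, g + b = M → b ≤ E * L → M < 2 * g := by
    intro g b h1 h2
    omega
  apply fin _ _ _ hbad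
  convert htot
end

section
/- Let d < B < N be positive integers and let P_1, ..., P_n be non-constant polynomials with integer coefficients of degree at most d whose coefficients all lie in (-\lceil N/2 \rceil, \lfloor N/2 \rfloor] \cap \mathbb{Z}. Let u_1 < u_2 < ... < u_M be distinct primes with B < u_1, where M = 2(n+1)\lfloor \log_{u_1} N \rfloor + 1. Then the number of indices m \in {1, ..., M} such that u_m hashes every support set S_j = {P_j(x) : x = 1, ..., B} (j = 1, ..., n) well is strictly greater than M/2. -/
open Polynomial in
lemma bad_dvd (B p : ℕ) (hp : p.Prime) (hBp : B < p) (Q : Polynomial ℤ)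
    (h0 : 0 < Q.natDegree) (hd : Q.natDegree < B)
    (hbad : ¬ 1 < ((Finset.Icc 1 B).image
          (fun x : ℕ => Q.eval (x : ℤ) % (p : ℤ))).card) :
    (p : ℤ) ∣ Q.leadingCoeff := by
  haveI : Fact p.Prime := ⟨hp⟩
  have hall : ∀ x ∈ Finset.Icc 1 B, Q.eval (x : ℤ) % (p : ℤ) = Q.eval ((1 : ℕ) : ℤ) % (p : ℤ) := by
    intro x hx
    refine Finset.card_le_one.1 (not_lt.1 hbad) _ (Finset.mem_image_of_mem _ hx) _
      (Finset.mem_image_of_mem (fun x : ℕ => Q.eval (x : ℤ) % (p : ℤ)) ?_)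
    simp; omega
  set c : ZMod p := ((Q.eval ((1 : ℕ) : ℤ) : ℤ) : ZMod p) with hc
  have hz : Q.map (Int.castRingHom (ZMod p)) - C c = 0 := by
    apply Polynomial.eq_zero_of_natDegree_lt_card_of_eval_eq_zero' _
      ((Finset.Icc 1 B).image (fun x : ℕ => (x : ZMod p)))
    · intro y hy
      obtain ⟨x, hx, rfl⟩ := Finset.mem_image.1 hy
      have h1 := (ZMod.intCast_eq_intCast_iff _ _ p).2 (hall x hx)
      have h2 : eval (x : ZMod p) (Q.map (Int.castRingHom (ZMod p)))
          = ((Q.eval (x : ℤ) : ℤ) : ZMod p) := by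
        have := Polynomial.eval_map_apply (f := Int.castRingHom (ZMod p)) (p := Q) (x : ℤ)
        simpa using this
      rw [eval_sub, eval_C, h2, h1, sub_self]
    · rw [Finset.card_image_of_injOn]
      · have := Polynomial.natDegree_map_le (f := Int.castRingHom (ZMod p)) (p := Q)
        rw [natDegree_sub_C]
        simp; omega
      · intro x hx y hy hxy
        simp at hx hy
        have := (ZMod.natCast_eq_natCast_iff' x y p).1 hxy
        rwa [Nat.mod_eq_of_lt (by omega), Nat.mod_eq_of_lt (by omega)] at this
  have h3 := congrArg (fun q => q.coeff Q.natDegree) hz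
  simp [coeff_C, h0.ne'] at h3
  exact (ZMod.intCast_zmod_eq_zero_iff_dvd _ p).1 (by simpa using h3)

lemma bad_card {M : ℕ} (u : Fin M → ℕ) (hu : ∀ m, (u m).Prime) (hinj : Function.Injective u)
    (q N a : ℕ) (hq : 1 < q) (hqu : ∀ m, q ≤ u m) (ha : a ≠ 0) (haN : a ≤ N)
    (s : Finset (Fin M)) (hs : ∀ m ∈ s, u m ∣ a) : s.card ≤ Nat.log q N := by
  have h1 : ∏ m ∈ s, u m ∣ a := by
    apply Finset.prod_dvd_of_isRelPrime _ hs
    intro x _ y _ hxy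
    exact Nat.coprime_iff_isRelPrime.1 ((Nat.coprime_primes (hu x) (hu y)).2 (hinj.ne hxy))
  have h2 : q ^ s.card ≤ ∏ m ∈ s, u m := Finset.pow_card_le_prod _ _ _ (fun m _ => hqu m)
  exact Nat.le_log_of_pow_le hq
    (h2.trans ((Nat.le_of_dvd (Nat.pos_of_ne_zero ha) h1).trans haN))

/-- Let `d < B < N` be positive integers and let `P_1, …, P_n` be
non-constant polynomials with integer coefficients of degree at most `d` whose coefficients
all lie in `(-⌈N/2⌉, ⌊N/2⌋] ∩ ℤ`. Let `u_1 < … < u_M` be distinct primes with `B < u_1`,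
where `M = 2(n+1)⌊log_{u_1} N⌋ + 1`. Then the number of indices `m ∈ {1, …, M}` such that
`u_m` hashes every support set `S_j = {P_j(x) : x = 1, …, B}` well is strictly greater than
`M/2`. -/
theorem stmt5 (d B N n M : ℕ) (hd : 0 < d) (hdB : d < B) (hBN : B < N)
    (P : Fin n → Polynomial ℤ)
    (hP0 : ∀ j, 0 < (P j).natDegree) (hdeg : ∀ j, (P j).natDegree ≤ d)
    (hcoeff : ∀ j k,
      (P j).coeff k ∈ Finset.Ioc (-(((N + 1) / 2 : ℕ) : ℤ)) ((N / 2 : ℕ) : ℤ))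
    (hM0 : 0 < M) (u : Fin M → ℕ) (hu : ∀ m, (u m).Prime) (hmono : StrictMono u)
    (hBu : B < u ⟨0, hM0⟩)
    (hM : M = 2 * (n + 1) * Nat.log (u ⟨0, hM0⟩) N + 1) :
    M < 2 * (Finset.univ.filter (fun m : Fin M => ∀ j : Fin n,
        1 < ((Finset.Icc 1 B).image
          (fun x : ℕ => (P j).eval (x : ℤ) % (u m : ℤ))).card)).card := by
  classical
  set q := u ⟨0, hM0⟩ with hq
  have hqu : ∀ m, q ≤ u m := fun m => hmono.monotone (by simp [Fin.le_def])
  set good : Fin n → Fin M → Prop := fun j m => 1 < ((Finset.Icc 1 B).image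
          (fun x : ℕ => (P j).eval (x : ℤ) % (u m : ℤ))).card with hgood
  change M < 2 * (Finset.univ.filter (fun m : Fin M => ∀ j : Fin n, good j m)).card
  have hb : ∀ j, (Finset.univ.filter (fun m => ¬ good j m)).card ≤ Nat.log q N := by
    intro j
    apply bad_card u hu hmono.injective q N (P j).leadingCoeff.natAbs (hu _).one_lt hqu
    · have : P j ≠ 0 := by
        intro h
        have := hP0 j
        simp [h] at this
      simpa using this
    · have := hcoeff j (P j).natDegree
      rw [Finset.mem_Ioc] at this
      unfold Polynomial.leadingCoeff
      omega
    · intro m hm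
      have := bad_dvd B (u m) (hu m) (hBu.trans_le (hqu m)) (P j) (hP0 j)
        ((hdeg j).trans_lt hdB) (Finset.mem_filter.1 hm).2
      exact Int.natCast_dvd.1 this
  have hU : (Finset.univ.filter (fun m : Fin M => ¬ ∀ j : Fin n, good j m)).card
      ≤ n * Nat.log q N := by
    have : (Finset.univ.filter (fun m : Fin M => ¬ ∀ j : Fin n, good j m))
        ⊆ Finset.univ.biUnion (fun j => Finset.univ.filter (fun m => ¬ good j m)) := by
      intro m hm
      simpa using hm
    refine (Finset.card_le_card this).trans ?_
    have := Finset.card_biUnion_le_card_mul (Finset.univ : Finset (Fin n))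
      (fun j => Finset.univ.filter (fun m => ¬ good j m)) _ (fun j _ => hb j)
    simpa using this
  have hT := Finset.card_filter_add_card_filter_not (s := (Finset.univ : Finset (Fin M)))
    (fun m : Fin M => ∀ j : Fin n, good j m)
  rw [Finset.card_univ, Fintype.card_fin] at hT
  have : 2 * (n + 1) * Nat.log q N = 2 * (n * Nat.log q N) + 2 * Nat.log q N := by ring
  omega
end

section
/- Let d < B be positive integers, let P be a non-constant polynomial with integer coefficients of degree at most d, and let p > B be a prime that does not divide the leading coefficient of P. Then p hashes the support set S = {P(x) : x = 1, ..., B} well, i.e., the set of residues {P(x) mod p : x = 1, ..., B} has more than one element. -/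
/-- Let `d < B` be positive integers, let `P` be a non-constant polynomial
with integer coefficients of degree at most `d`, and let `p > B` be a prime that does not
divide the leading coefficient of `P`. Then `p` hashes the support set
`S = {P(x) : x = 1, …, B}` well, i.e. `{P(x) mod p : x = 1, …, B}` has more than one
element. -/
theorem stmt6 (d B : ℕ) (hd : 0 < d) (hdB : d < B) (P : Polynomial ℤ)
    (hP0 : 0 < P.natDegree) (hdeg : P.natDegree ≤ d)
    (p : ℕ) (hp : p.Prime) (hpB : B < p) (hlead : ¬ ((p : ℤ) ∣ P.leadingCoeff)) :
    1 < ((Finset.Icc 1 B).image (fun x : ℕ => P.eval (x : ℤ) % (p : ℤ))).card := by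
  by_contra hcon
  have hcard := Finset.card_le_one.1 (not_lt.1 hcon)
  haveI : Fact p.Prime := ⟨hp⟩
  set f := Int.castRingHom (ZMod p) with hf
  have hlc : f P.leadingCoeff ≠ 0 := by
    intro h
    exact hlead ((ZMod.intCast_zmod_eq_zero_iff_dvd _ p).1 (by simpa [hf] using h))
  have hdegQ : (P.map f - Polynomial.C (f (P.eval 1))).natDegree = P.natDegree := by
    rw [Polynomial.natDegree_sub_C, Polynomial.natDegree_map_of_leadingCoeff_ne_zero f hlc]
  have hinj : Set.InjOn (fun x : ℕ => (x : ZMod p)) (Finset.Icc 1 B : Finset ℕ) := by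
    intro x hx y hy hxy
    simp only [Finset.coe_Icc, Set.mem_Icc] at hx hy
    have h := (ZMod.natCast_eq_natCast_iff' x y p).1 hxy
    rwa [Nat.mod_eq_of_lt (by omega), Nat.mod_eq_of_lt (by omega)] at h
  have hz : P.map f - Polynomial.C (f (P.eval 1)) = 0 := by
    apply Polynomial.eq_zero_of_natDegree_lt_card_of_eval_eq_zero' _
      ((Finset.Icc 1 B).image (fun x : ℕ => (x : ZMod p)))
    · intro i hi
      obtain ⟨x, hx, rfl⟩ := Finset.mem_image.1 hi
      have h := hcard _ (Finset.mem_image_of_mem _ hx) _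
        (Finset.mem_image_of_mem _ (Finset.mem_Icc.2 ⟨le_refl 1, by omega⟩))
      have h2 : ((P.eval (x : ℤ) : ℤ) : ZMod p) = ((P.eval 1 : ℤ) : ZMod p) := by
        rw [ZMod.intCast_eq_intCast_iff']
        simpa using h
      have h3 : (P.map f).eval (x : ZMod p) = f (P.eval (x : ℤ)) := by
        have := Polynomial.eval_map_apply (f := f) (p := P) (x : ℤ)
        simpa using this
      rw [Polynomial.eval_sub, Polynomial.eval_C, h3, sub_eq_zero]
      exact h2
    · rw [Finset.card_image_of_injOn hinj, hdegQ, Nat.card_Icc]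
      omega
  rw [hz, Polynomial.natDegree_zero] at hdegQ
  omega
end

section
/- Let d < B be positive integers and let P(x) = \sum_{k=0}^d a_k x^k be a non-constant polynomial with integer coefficients of degree at most d such that gcd(a_1, ..., a_d) < B. Then every prime u > B hashes the support set S = {P(x) : x = 1, ..., B} well, i.e., the set of residues {P(x) mod u : x = 1, ..., B} has more than one element. -/
/-- Let `d < B` be positive integers and let `P(x) = ∑_{k=0}^d a_k x^k` be
a non-constant polynomial with integer coefficients of degree at most `d` such that
`gcd(a_1, …, a_d) < B`. Then every prime `u > B` hashes the support set
`S = {P(x) : x = 1, …, B}` well, i.e. `{P(x) mod u : x = 1, …, B}` has more than one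
element. -/
theorem stmt7 (d B : ℕ) (hd : 0 < d) (hdB : d < B) (P : Polynomial ℤ)
    (hP0 : 0 < P.natDegree) (hdeg : P.natDegree ≤ d)
    (hgcd : Finset.gcd (Finset.Icc 1 d) (fun k => P.coeff k) < (B : ℤ)) :
    ∀ u : ℕ, u.Prime → B < u →
      1 < ((Finset.Icc 1 B).image (fun x : ℕ => P.eval (x : ℤ) % (u : ℤ))).card := by
  intro u hu hBu
  by_contra hcard
  have : Fact u.Prime := ⟨hu⟩
  rw [not_lt, Finset.card_le_one] at hcard
  have hval : ∀ x ∈ Finset.Icc 1 B, ((P.eval (x : ℤ) : ℤ) : ZMod u) = ((P.eval 1 : ℤ) : ZMod u) := by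
    intro x hx
    have h := hcard _ (Finset.mem_image_of_mem _ hx) _
      (Finset.mem_image_of_mem _ (show 1 ∈ Finset.Icc 1 B from Finset.mem_Icc.2 ⟨le_refl _, by omega⟩))
    rw [ZMod.intCast_eq_intCast_iff]
    simpa [Int.ModEq] using h
  set Q : Polynomial (ZMod u) := (P - Polynomial.C (P.eval 1)).map (Int.castRingHom (ZMod u)) with hQ
  have hdegQ : Q.natDegree ≤ d := by
    refine le_trans Polynomial.natDegree_map_le ?_
    rw [Polynomial.natDegree_sub_C]
    exact hdeg
  have hinj : Set.InjOn (fun x : ℕ => (x : ZMod u)) (Finset.Icc 1 B : Finset ℕ) := by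
    intro x hx y hy hxy
    rw [Finset.mem_coe, Finset.mem_Icc] at hx hy
    have h := (ZMod.natCast_eq_natCast_iff' x y u).1 hxy
    rwa [Nat.mod_eq_of_lt (by omega), Nat.mod_eq_of_lt (by omega)] at h
  have hQ0 : Q = 0 := by
    refine Polynomial.eq_zero_of_natDegree_lt_card_of_eval_eq_zero' Q
      ((Finset.Icc 1 B).image (fun x : ℕ => (x : ZMod u))) ?_ ?_
    · intro y hy
      obtain ⟨x, hx, rfl⟩ := Finset.mem_image.1 hy
      have h := hval x hx
      have e := Polynomial.eval_intCast_map (Int.castRingHom (ZMod u)) (P - Polynomial.C (P.eval 1)) (x : ℤ)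
      rw [← hQ] at e
      simp only [Int.cast_natCast] at e
      rw [e]
      simp [h]
    · rw [Finset.card_image_of_injOn hinj, Nat.card_Icc]
      omega
  have hdvd : (u : ℤ) ∣ Finset.gcd (Finset.Icc 1 d) (fun k => P.coeff k) := by
    refine Finset.dvd_gcd fun k hk => ?_
    have hk1 : k ≠ 0 := by
      rw [Finset.mem_Icc] at hk
      omega
    have h : Q.coeff k = 0 := by rw [hQ0, Polynomial.coeff_zero]
    rw [hQ, Polynomial.coeff_map, Polynomial.coeff_sub, Polynomial.coeff_C, if_neg hk1, sub_zero] at h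
    exact (ZMod.intCast_zmod_eq_zero_iff_dvd _ u).1 h
  have hne : Finset.gcd (Finset.Icc 1 d) (fun k => P.coeff k) ≠ 0 := by
    intro h
    have h2 := Finset.gcd_eq_zero_iff.1 h P.natDegree (Finset.mem_Icc.2 ⟨hP0, hdeg⟩)
    have h3 := Polynomial.leadingCoeff_eq_zero.1 h2
    simp [h3] at hP0
  have hnn : 0 ≤ Finset.gcd (Finset.Icc 1 d) (fun k => P.coeff k) :=
    Int.nonneg_of_normalize_eq_self Finset.normalize_gcd
  have := Int.le_of_dvd (lt_of_le_of_ne hnn hne.symm) hdvd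
  omega
end

section
/- Let d < B be positive integers, let P(x) = \sum_{k=0}^d a_k x^k be a polynomial with integer coefficients of degree at most d, and let u > B be a prime such that u does not divide \sum_{k=1}^d a_k. Then u hashes the support set S = {P(x) : x = 1, ..., B} well, i.e., the set of residues {P(x) mod u : x = 1, ..., B} has more than one element. -/
/-- Let `d < B` be positive integers, let `P(x) = ∑_{k=0}^d a_k x^k` be a
polynomial with integer coefficients of degree at most `d`, and let `u > B` be a prime such
that `u` does not divide `∑_{k=1}^d a_k`. Then `u` hashes the support set
`S = {P(x) : x = 1, …, B}` well, i.e. `{P(x) mod u : x = 1, …, B}` has more than one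
element. -/
theorem stmt11 (d B : ℕ) (hd : 0 < d) (hdB : d < B) (P : Polynomial ℤ)
    (hdeg : P.natDegree ≤ d) (u : ℕ) (hu : u.Prime) (huB : B < u)
    (hdvd : ¬ ((u : ℤ) ∣ ∑ k ∈ Finset.Icc 1 d, P.coeff k)) :
    1 < ((Finset.Icc 1 B).image (fun x : ℕ => P.eval (x : ℤ) % (u : ℤ))).card := by
  by_contra hcon
  have hcard := Finset.card_le_one.mp (not_lt.mp hcon)
  have : Fact u.Prime := ⟨hu⟩
  have heq : ∀ x ∈ Finset.Icc 1 B,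
      ((P.eval (x : ℤ) : ℤ) : ZMod u) = ((P.eval (1 : ℤ) : ℤ) : ZMod u) := by
    intro x hx
    have h := hcard _ (Finset.mem_image_of_mem _ hx) _
      (Finset.mem_image_of_mem _ (Finset.mem_Icc.mpr ⟨le_refl 1, by omega⟩ : 1 ∈ Finset.Icc 1 B))
    rw [ZMod.intCast_eq_intCast_iff]
    simpa [Int.ModEq] using h
  have hzero : P.map (Int.castRingHom (ZMod u))
      - Polynomial.C ((P.eval (1 : ℤ) : ℤ) : ZMod u) = 0 := by
    apply Polynomial.eq_zero_of_natDegree_lt_card_of_eval_eq_zero' _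
      ((Finset.Icc 1 B).image (fun x : ℕ => (x : ZMod u)))
    · intro y hy
      obtain ⟨x, hx, rfl⟩ := Finset.mem_image.mp hy
      have h := heq x hx
      have h2 := Polynomial.eval_intCast_map (Int.castRingHom (ZMod u)) P (x : ℤ)
      simp only [Int.cast_natCast, eq_intCast] at h2
      rw [Polynomial.eval_sub, Polynomial.eval_C, h2]
      simpa [sub_eq_zero] using h
    · rw [Finset.card_image_of_injOn]
      · rw [Polynomial.natDegree_sub_C, Nat.card_Icc]
        have := Polynomial.natDegree_map_le (f := Int.castRingHom (ZMod u)) (p := P)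
        omega
      · intro a ha b hb hab
        simp only [Finset.coe_Icc, Set.mem_Icc] at ha hb
        have h := (ZMod.natCast_eq_natCast_iff' a b u).mp hab
        rwa [Nat.mod_eq_of_lt (by omega), Nat.mod_eq_of_lt (by omega)] at h
  apply hdvd
  apply Finset.dvd_sum
  intro k hk
  have hk1 := (Finset.mem_Icc.mp hk).1
  rw [← ZMod.intCast_zmod_eq_zero_iff_dvd]
  have h := congrArg (fun q => Polynomial.coeff q k) hzero
  simp only [Polynomial.coeff_sub, Polynomial.coeff_map, Polynomial.coeff_C,
    show k ≠ 0 by omega, if_false, sub_zero, Polynomial.coeff_zero, eq_intCast] at h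
  exact h
end

section
/- Let d < B be positive integers, let P(x) = \sum_{k=0}^d a_k x^k be a polynomial with integer coefficients of degree at most d, and let u > B be a prime such that there exists a sign pattern \varepsilon \in {0,1}^d with u not dividing \sum_{k=1}^d (-1)^{\varepsilon_k} a_k. Then u hashes the support set S = {P(x) : x = 1, ..., B} well, i.e., the set of residues {P(x) mod u : x = 1, ..., B} has more than one element. -/
/-- Let `d < B` be positive integers, let `P(x) = ∑_{k=0}^d a_k x^k` be a
polynomial with integer coefficients of degree at most `d`, and let `u > B` be a prime such
that there exists a sign pattern `ε ∈ {0,1}^d` with `u` not dividing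
`∑_{k=1}^d (-1)^{ε_k} a_k`. Then `u` hashes the support set `S = {P(x) : x = 1, …, B}` well,
i.e. `{P(x) mod u : x = 1, …, B}` has more than one element. -/
theorem stmt12 (d B : ℕ) (hd : 0 < d) (hdB : d < B) (P : Polynomial ℤ)
    (hdeg : P.natDegree ≤ d) (u : ℕ) (hu : u.Prime) (huB : B < u)
    (hsign : ∃ ε : ℕ → ℕ, (∀ k, ε k ≤ 1) ∧
      ¬ ((u : ℤ) ∣ ∑ k ∈ Finset.Icc 1 d, (-1 : ℤ) ^ (ε k) * P.coeff k)) :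
    1 < ((Finset.Icc 1 B).image (fun x : ℕ => P.eval (x : ℤ) % (u : ℤ))).card := by
  
  obtain ⟨ε, -, hnd⟩ := hsign
  by_contra hcard
  have hcard' := Finset.card_le_one.mp (not_lt.mp hcard)
  apply hnd
  haveI : Fact u.Prime := ⟨hu⟩
  set c : ZMod u := ((P.eval 1 : ℤ) : ZMod u) with hc
  set Q : Polynomial (ZMod u) := P.map (Int.castRingHom (ZMod u)) - Polynomial.C c with hQ
  have hinj : Set.InjOn (fun x : ℕ => (x : ZMod u)) (Finset.Icc 1 B : Finset ℕ) := by
    intro x hx y hy hxy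
    simp only [Finset.coe_Icc, Set.mem_Icc] at hx hy
    have h := (ZMod.natCast_eq_natCast_iff' x y u).mp hxy
    rwa [Nat.mod_eq_of_lt (by omega), Nat.mod_eq_of_lt (by omega)] at h
  have hQ0 : Q = 0 := by
    apply Polynomial.eq_zero_of_natDegree_lt_card_of_eval_eq_zero' Q
      ((Finset.Icc 1 B).image (fun x : ℕ => (x : ZMod u)))
    · intro y hy
      obtain ⟨x, hx, rfl⟩ := Finset.mem_image.mp hy
      have h := hcard' _ (Finset.mem_image_of_mem _ hx) _
        (Finset.mem_image_of_mem _ (Finset.mem_Icc.mpr ⟨le_refl 1, by omega⟩))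
      have h2 := (ZMod.intCast_eq_intCast_iff' _ _ u).mpr h
      have h3 := Polynomial.eval_intCast_map (Int.castRingHom (ZMod u)) P (x : ℤ)
      simp only [Int.cast_natCast, eq_intCast] at h3
      rw [hQ, Polynomial.eval_sub, Polynomial.eval_C, h3, h2, hc]
      simp
    · rw [Finset.card_image_of_injOn hinj, Nat.card_Icc]
      have h1 : Q.natDegree ≤ P.natDegree := by
        rw [hQ, Polynomial.natDegree_sub_C]
        exact Polynomial.natDegree_map_le
      omega
  apply Finset.dvd_sum
  intro k hk
  apply Dvd.dvd.mul_left
  have hk1 := (Finset.mem_Icc.mp hk).1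
  have h := congrArg (fun q => Polynomial.coeff q k) hQ0
  simp only [hQ, Polynomial.coeff_sub, Polynomial.coeff_map, Polynomial.coeff_C,
    Polynomial.coeff_zero, if_neg (show k ≠ 0 by omega), sub_zero, eq_intCast] at h
  exact (ZMod.intCast_zmod_eq_zero_iff_dvd _ u).mp h
end

section
/- Let f : \mathbb{R} \to \mathbb{C} be any function, let a and b be coprime positive integers, and let q be a positive integer divisible by a\cdot b. Let h \in {0, ..., a-1} and \nu \in {0, ..., b-1}, and let \tau \in {0, ..., ab-1} be the unique residue with \tau \equiv h (mod a) and \tau \equiv \nu (mod b). Then \sum_{j=0, j \equiv h (mod a), j \equiv \nu (mod b)}^{q-1} \hat{A}_q(j) = \hat{A}_{ab}(\tau), where the sum ranges over all j \in {0, ..., q-1} congruent to h modulo a and to \nu modulo b. -/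
open scoped BigOperators

/-- For a function `f : ℝ → ℂ` and a positive integer `r`, the discrete Fourier transform of
the `r` equispaced samples `A_r(b) = f(2πb/r)`, evaluated at an integer frequency `j`:
`Â_r(j) := (1/r) ∑_{b=0}^{r-1} f(2πb/r) e^{-2πijb/r}`. -/
noncomputable def dftHat (f : ℝ → ℂ) (r : ℕ) (j : ℤ) : ℂ :=
  (1 / (r : ℂ)) * ∑ b ∈ Finset.range r,
    f (2 * Real.pi * b / r) *
      Complex.exp (-(2 * (Real.pi : ℂ) * Complex.I * (j : ℂ) * (b : ℂ)) / (r : ℂ))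

lemma dftInnerSum (m : ℕ) (hm : 0 < m) (c : ℕ) :
    ∑ k ∈ Finset.range m,
      Complex.exp (-(2 * (Real.pi : ℂ) * Complex.I * (k : ℂ) * (c : ℂ)) / (m : ℂ)) =
      if m ∣ c then (m : ℂ) else 0 := by
  have hp := (Complex.isPrimitiveRoot_exp m hm.ne').inv
  set z := (Complex.exp (2 * (Real.pi : ℂ) * Complex.I / (m : ℂ)))⁻¹ with hz
  have key : ∀ k ∈ Finset.range m,
      Complex.exp (-(2 * (Real.pi : ℂ) * Complex.I * (k : ℂ) * (c : ℂ)) / (m : ℂ))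
        = (z ^ c) ^ k := by
    intro k _
    rw [hz, ← Complex.exp_neg, ← Complex.exp_nat_mul, ← Complex.exp_nat_mul]
    congr 1
    ring
  rw [Finset.sum_congr rfl key]
  split_ifs with hd
  · rw [(hp.pow_eq_one_iff_dvd c).2 hd]
    simp
  · have h1 : z ^ c ≠ 1 := fun h => hd ((hp.pow_eq_one_iff_dvd c).1 h)
    rw [geom_sum_eq h1, ← pow_mul, mul_comm, pow_mul, hp.pow_eq_one]
    simp

lemma dftCore (f : ℝ → ℂ) (n m τ : ℕ) (hn : 0 < n) (hm : 0 < m) :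
    ∑ k ∈ Finset.range m, dftHat f (n * m) ((τ + n * k : ℕ) : ℤ) = dftHat f n (τ : ℤ) := by
  have hn' : (n : ℂ) ≠ 0 := by exact_mod_cast hn.ne'
  have hm' : (m : ℂ) ≠ 0 := by exact_mod_cast hm.ne'
  have hnR : (n : ℝ) ≠ 0 := by exact_mod_cast hn.ne'
  have hmR : (m : ℝ) ≠ 0 := by exact_mod_cast hm.ne'
  unfold dftHat
  rw [← Finset.mul_sum, Finset.sum_comm]
  have e : ∀ c ∈ Finset.range (n * m), ∑ k ∈ Finset.range m,
      f (2 * Real.pi * c / (n * m : ℕ)) *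
      Complex.exp (-(2 * (Real.pi : ℂ) * Complex.I * (((τ + n * k : ℕ) : ℤ) : ℂ) * (c : ℂ))
        / ((n * m : ℕ) : ℂ)) =
      if m ∣ c then f (2 * Real.pi * c / (n * m : ℕ)) *
        Complex.exp (-(2 * (Real.pi : ℂ) * Complex.I * (τ : ℂ) * (c : ℂ)) / ((n * m : ℕ) : ℂ))
        * m else 0 := by
    intro c _
    have := dftInnerSum m hm c
    rw [← mul_ite_zero, ← this, Finset.mul_sum]
    refine Finset.sum_congr rfl fun k _ => ?_
    rw [mul_assoc (f _), ← Complex.exp_add]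
    congr 2
    push_cast
    field_simp
    ring
  rw [Finset.sum_congr rfl e, ← Finset.sum_filter]
  have r : (Finset.range (n * m)).filter (fun c => m ∣ c)
      = (Finset.range n).image (fun d => d * m) := by
    ext c
    simp only [Finset.mem_filter, Finset.mem_range, Finset.mem_image]
    constructor
    · rintro ⟨h1, d, rfl⟩
      exact ⟨d, by rw [mul_comm m d] at h1; exact lt_of_mul_lt_mul_right h1 hm.le, mul_comm _ _⟩
    · rintro ⟨d, hd, rfl⟩
      exact ⟨Nat.mul_lt_mul_of_pos_right hd hm, Dvd.intro_left d rfl⟩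
  rw [r, Finset.sum_image (fun x _ y _ hxy => Nat.eq_of_mul_eq_mul_right hm hxy),
    Finset.mul_sum, Finset.mul_sum]
  refine Finset.sum_congr rfl fun d _ => ?_
  have e1 : 2 * Real.pi * ((d * m : ℕ) : ℝ) / ((n * m : ℕ) : ℝ) = 2 * Real.pi * d / n := by
    push_cast
    field_simp
  have e2 : -(2 * (Real.pi : ℂ) * Complex.I * (τ : ℂ) * ((d * m : ℕ) : ℂ)) / ((n * m : ℕ) : ℂ)
      = -(2 * (Real.pi : ℂ) * Complex.I * ((τ : ℤ) : ℂ) * (d : ℂ)) / (n : ℂ) := by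
    push_cast
    field_simp
  rw [e1, e2]
  push_cast
  field_simp

/-- Let `f : ℝ → ℂ` be any function, let `a` and `b` be coprime positive
integers, and let `q` be a positive integer divisible by `a·b`. Let `h ∈ {0, …, a-1}` and
`ν ∈ {0, …, b-1}`, and let `τ ∈ {0, …, ab-1}` be the unique residue with `τ ≡ h (mod a)` and
`τ ≡ ν (mod b)`. Then `∑_{j < q, j ≡ h (mod a), j ≡ ν (mod b)} Â_q(j) = Â_{ab}(τ)`. -/
theorem stmt15 (f : ℝ → ℂ) (a b : ℕ) (ha : 0 < a) (hb : 0 < b)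
    (hab : Nat.Coprime a b) (q : ℕ) (hq : 0 < q) (hdvd : a * b ∣ q)
    (h ν τ : ℕ) (hh : h < a) (hν : ν < b) (hτ : τ < a * b)
    (hτa : τ % a = h) (hτb : τ % b = ν) :
    ∑ j ∈ (Finset.range q).filter (fun j => j % a = h ∧ j % b = ν),
      dftHat f q (j : ℤ) = dftHat f (a * b) (τ : ℤ) := by
  obtain ⟨m, rfl⟩ := hdvd
  have hn : 0 < a * b := Nat.mul_pos ha hb
  have hm : 0 < m := Nat.pos_of_mul_pos_left hq
  rw [← dftCore f (a * b) m τ hn hm]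
  have r : (Finset.range (a * b * m)).filter (fun j => j % a = h ∧ j % b = ν)
      = (Finset.range m).image (fun k => τ + a * b * k) := by
    ext j
    simp only [Finset.mem_filter, Finset.mem_range, Finset.mem_image]
    constructor
    · rintro ⟨h1, h2, h3⟩
      have hc : j ≡ τ [MOD a * b] :=
        (Nat.modEq_and_modEq_iff_modEq_mul hab).1 ⟨h2.trans hτa.symm, h3.trans hτb.symm⟩
      have hc' : j % (a * b) = τ := by
        rw [hc, Nat.mod_eq_of_lt hτ]
      exact ⟨j / (a * b), Nat.div_lt_of_lt_mul h1, by
        rw [← hc']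
        exact Nat.mod_add_div j (a * b)⟩
    · rintro ⟨k, hk, rfl⟩
      refine ⟨?_, ?_, ?_⟩
      · calc τ + a * b * k < a * b + a * b * k := by omega
          _ = a * b * (k + 1) := by ring
          _ ≤ a * b * m := Nat.mul_le_mul_left _ hk
      · rw [mul_assoc, Nat.add_mul_mod_self_left, hτa]
      · rw [mul_comm a b, mul_assoc, Nat.add_mul_mod_self_left, hτb]
  rw [r, Finset.sum_image]
  intro x _ y _ hxy
  exact Nat.eq_of_mul_eq_mul_left hn (Nat.add_left_cancel hxy)
end
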